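/- arXiv:2603.01527 — 4 statements merged into one kernel-verified Lean document; each statement's English description precedes it below -/
import Mathlib

section
/- Let U be a multivalued process on a metric space (X,d) which is upper semicontinuous and has closed values, let D be a universe in X, let D̂_0 = {D_0(t)}_{t∈ℝ} be a pullback D-absorbing family for U, and assume U is pullback D-asymptotically compact. Then the family A = {A(t)}_{t∈ℝ} defined by A(t) = closure(⋃_{D̂∈D} Λ(D̂,t)) is minimal among pullback D-attracting families of closed sets: for any family Ĉ = {C(t)}_{t∈ℝ} of closed subsets of X that pullback attracts every D̂ ∈ D, one has A(t) ⊆ C(t) for every t ∈ ℝ. -/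
open Set Filter Topology

/-- The image of a set `D` under the multivalued map `U t τ`. -/
def procSet {X : Type*} (U : ℝ → ℝ → X → Set X) (t τ : ℝ) (D : Set X) : Set X :=
  ⋃ x ∈ D, U t τ x

/-- `U` is a multivalued process: nonempty values, identity at equal times,
and the (sub)process property. -/
def IsMVProcess {X : Type*} (U : ℝ → ℝ → X → Set X) : Prop :=
  (∀ t τ x, τ ≤ t → (U t τ x).Nonempty) ∧
  (∀ τ x, U τ τ x = {x}) ∧
  (∀ t s r x, r ≤ s → s ≤ t → U t r x ⊆ procSet U t s (U s r x))

/-- A strict multivalued process: the process inclusion is an equality. -/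
def IsStrictMVProcess {X : Type*} (U : ℝ → ℝ → X → Set X) : Prop :=
  IsMVProcess U ∧ ∀ t s r x, r ≤ s → s ≤ t → U t r x = procSet U t s (U s r x)

/-- Upper semicontinuity of the multivalued process. -/
def IsUSCProcess {X : Type*} [MetricSpace X] (U : ℝ → ℝ → X → Set X) : Prop :=
  ∀ t τ x, τ ≤ t → ∀ N : Set X, IsOpen N → U t τ x ⊆ N →
    ∃ M ∈ 𝓝 x, ∀ y ∈ M, U t τ y ⊆ N

/-- A universe: a nonempty class of families of nonempty subsets, indexed by time. -/
def IsUniverse {X : Type*} (𝒟 : Set (ℝ → Set X)) : Prop :=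
  𝒟.Nonempty ∧ ∀ D ∈ 𝒟, ∀ t : ℝ, (D t).Nonempty

/-- The family `D0` is pullback `𝒟`-absorbing for `U`. -/
def PullbackAbsorbing {X : Type*} (U : ℝ → ℝ → X → Set X) (𝒟 : Set (ℝ → Set X))
    (D0 : ℝ → Set X) : Prop :=
  ∀ t : ℝ, ∀ D ∈ 𝒟, ∃ τ0 ≤ t, ∀ τ ≤ τ0, procSet U t τ (D τ) ⊆ D0 t

/-- `U` is pullback asymptotically compact with respect to the single family `D`. -/
def AsympCompactFor {X : Type*} [MetricSpace X] (U : ℝ → ℝ → X → Set X)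
    (D : ℝ → Set X) : Prop :=
  ∀ t : ℝ, ∀ τn : ℕ → ℝ, ∀ xn yn : ℕ → X,
    (∀ n, τn n ≤ t) → Tendsto τn atTop atBot →
    (∀ n, xn n ∈ D (τn n)) → (∀ n, yn n ∈ U t (τn n) (xn n)) →
    IsCompact (closure (Set.range yn))

/-- `U` is pullback `𝒟`-asymptotically compact. -/
def AsympCompact {X : Type*} [MetricSpace X] (U : ℝ → ℝ → X → Set X)
    (𝒟 : Set (ℝ → Set X)) : Prop :=
  ∀ D ∈ 𝒟, AsympCompactFor U D

/-- The family `A` pullback attracts the family `D`: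
`dist (U(t,τ,D(τ)), A(t)) → 0` as `τ → -∞`, for every `t`. -/
def PullbackAttracts {X : Type*} [MetricSpace X] (U : ℝ → ℝ → X → Set X)
    (A D : ℝ → Set X) : Prop :=
  ∀ t : ℝ, ∀ ε > (0:ℝ), ∃ T : ℝ, ∀ τ ≤ T, ∀ y ∈ procSet U t τ (D τ),
    ∃ a ∈ A t, dist y a < ε

/-- The omega-limit set of the family `D` at time `t`. -/
def pbOmegaLimit {X : Type*} [MetricSpace X] (U : ℝ → ℝ → X → Set X)
    (D : ℝ → Set X) (t : ℝ) : Set X :=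
  ⋂ s ∈ Iic t, closure (⋃ τ ∈ Iic s, procSet U t τ (D τ))

/-- The candidate attractor: closure of the union of the omega-limit sets
of all families of the universe. -/
def attractorFamily {X : Type*} [MetricSpace X] (U : ℝ → ℝ → X → Set X)
    (𝒟 : Set (ℝ → Set X)) (t : ℝ) : Set X :=
  closure (⋃ D ∈ 𝒟, pbOmegaLimit U D t)

/-- The omega-limit set of a family is contained in every closed family attracting it. -/
theorem pbOmegaLimit_subset_of_pullbackAttracts {X : Type*} [MetricSpace X]
    {U : ℝ → ℝ → X → Set X} {C D : ℝ → Set X} {t : ℝ} (hC : IsClosed (C t))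
    (hCD : PullbackAttracts U C D) : pbOmegaLimit U D t ⊆ C t := by
  intro y hy
  rw [← hC.closure_eq, Metric.mem_closure_iff]
  intro ε hε
  obtain ⟨T, hT⟩ := hCD t (ε / 2) (half_pos hε)
  have hy' := mem_iInter₂.1 hy (min T t) (min_le_right T t)
  obtain ⟨z, hz, hyz⟩ := Metric.mem_closure_iff.1 hy' (ε / 2) (half_pos hε)
  obtain ⟨τ, hτ, hzτ⟩ := mem_iUnion₂.1 hz
  obtain ⟨a, ha, hza⟩ := hT τ (le_trans hτ (min_le_left T t)) z hzτ
  exact ⟨a, ha, by linarith [dist_triangle y z a]⟩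

/-- Theorem (minimality of the pullback attractor): under the standing assumptions,
`A(t) = closure (⋃_{D ∈ 𝒟} Λ(D,t))` is minimal among families of closed sets that
pullback attract every member of `𝒟`. -/
theorem attractor_minimality {X : Type*} [MetricSpace X] (U : ℝ → ℝ → X → Set X)
    (𝒟 : Set (ℝ → Set X)) (D0 : ℝ → Set X)
    (hU : IsMVProcess U) (husc : IsUSCProcess U)
    (hclosed : ∀ t τ x, IsClosed (U t τ x))
    (h𝒟 : IsUniverse 𝒟) (hD0ne : ∀ t, (D0 t).Nonempty)
    (habs : PullbackAbsorbing U 𝒟 D0) (hac : AsympCompact U 𝒟) :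
    ∀ C : ℝ → Set X, (∀ t, IsClosed (C t)) → (∀ D ∈ 𝒟, PullbackAttracts U C D) →
      ∀ t : ℝ, attractorFamily U 𝒟 t ⊆ C t := by
  intro C hC hattr t
  exact closure_minimal
    (iUnion₂_subset fun D hD => pbOmegaLimit_subset_of_pullbackAttracts (hC t) (hattr D hD)) (hC t)
end

section
/- Let U be a multivalued process on a metric space (X,d) which is upper semicontinuous and has closed values, let D be a universe in X, let D̂_0 = {D_0(t)}_{t∈ℝ} be a pullback D-absorbing family for U, and assume U is pullback D-asymptotically compact. Define A(t) = closure(⋃_{D̂∈D} Λ(D̂,t)). If moreover the family A = {A(t)}_{t∈ℝ} belongs to the universe D and U is a strict process, then A is strictly invariant under U, i.e. A(t) = U(t,τ,A(τ)) for all τ ≤ t. -/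
open Set Filter Topology

theorem IsUSCProcess.mem_of_tendsto {X : Type*} [MetricSpace X] {U : ℝ → ℝ → X → Set X}
    (husc : IsUSCProcess U) {t τ : ℝ} (hτ : τ ≤ t) {y z : X} (hc : IsClosed (U t τ z))
    {yn zn : ℕ → X} (hy : Tendsto yn atTop (𝓝 y)) (hz : Tendsto zn atTop (𝓝 z))
    (h : ∀ n, yn n ∈ U t τ (zn n)) : y ∈ U t τ z := by
  by_contra hn
  obtain ⟨K, hK, hKc, hKs⟩ := exists_mem_nhds_isClosed_subset (hc.isOpen_compl.mem_nhds hn)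
  obtain ⟨M, hM, hMU⟩ := husc t τ z hτ Kᶜ hKc.isOpen_compl (subset_compl_comm.mp hKs)
  obtain ⟨n, hn1, hn2⟩ := ((hy.eventually_mem hK).and (hz.eventually_mem hM)).exists
  exact hMU _ hn2 (h n) hn1

theorem isClosed_pbOmegaLimit {X : Type*} [MetricSpace X] (U : ℝ → ℝ → X → Set X)
    (D : ℝ → Set X) (t : ℝ) : IsClosed (pbOmegaLimit U D t) :=
  isClosed_biInter fun _ _ => isClosed_closure

theorem mem_pbOmegaLimit_of_forall_le {X : Type*} [MetricSpace X] {U : ℝ → ℝ → X → Set X}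
    {D : ℝ → Set X} {t τ : ℝ} {y : X} (h : ∀ s ≤ τ, y ∈ procSet U t s (D s)) :
    y ∈ pbOmegaLimit U D t := by
  refine mem_iInter₂.mpr fun s _ => subset_closure ?_
  exact mem_iUnion₂.mpr ⟨min s τ, mem_Iic.mpr (min_le_left s τ), h _ (min_le_right _ _)⟩

theorem pbOmegaLimit_subset_procSet {X : Type*} [MetricSpace X] {U : ℝ → ℝ → X → Set X}
    (hU : IsMVProcess U) (husc : IsUSCProcess U) (hclosed : ∀ t τ x, IsClosed (U t τ x))
    {D : ℝ → Set X} (hac : AsympCompactFor U D) {τ t : ℝ} (hτ : τ ≤ t) :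
    pbOmegaLimit U D t ⊆ procSet U t τ (pbOmegaLimit U D τ) := by
  intro y hy
  have key : ∀ n : ℕ, ∃ σ x z w, σ ≤ min τ (-n) ∧ x ∈ D σ ∧ z ∈ U τ σ x ∧ w ∈ U t τ z ∧
      dist y w < 1 / ((n : ℝ) + 1) := by
    intro n
    have hcl := mem_iInter₂.mp hy (min τ (-n)) ((min_le_left _ _).trans hτ)
    obtain ⟨w, hw, hd⟩ := Metric.mem_closure_iff.mp hcl _ (Nat.one_div_pos_of_nat (n := n))
    obtain ⟨σ, hσ, hw⟩ := mem_iUnion₂.mp hw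
    obtain ⟨x, hx, hw⟩ := mem_iUnion₂.mp hw
    obtain ⟨z, hz, hw⟩ :=
      mem_iUnion₂.mp (hU.2.2 t τ σ x (le_trans hσ (min_le_left _ _)) hτ hw)
    exact ⟨σ, x, z, w, hσ, hx, hz, hw, hd⟩
  choose σ x z w hσ hx hz hw hd using key
  have hσbot : Tendsto σ atTop atBot :=
    tendsto_atBot_mono (fun n => (hσ n).trans (min_le_right _ _))
      (tendsto_neg_atTop_atBot.comp tendsto_natCast_atTop_atTop)
  have hwy : Tendsto w atTop (𝓝 y) := by
    rw [tendsto_iff_dist_tendsto_zero]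
    exact squeeze_zero (fun _ => dist_nonneg) (fun n => (dist_comm (w n) y).trans_le (hd n).le)
      tendsto_one_div_add_atTop_nhds_zero_nat
  have hcpt := hac τ σ x z (fun n => (hσ n).trans (min_le_left _ _)) hσbot hx hz
  obtain ⟨a, -, φ, hφ, hza⟩ := hcpt.tendsto_subseq fun n => subset_closure (mem_range_self n)
  refine mem_iUnion₂.mpr ⟨a, mem_iInter₂.mpr fun s _ => ?_,
    husc.mem_of_tendsto hτ (hclosed _ _ _) (hwy.comp hφ.tendsto_atTop) hza fun n => hw (φ n)⟩
  refine mem_closure_of_tendsto hza ?_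
  filter_upwards [(hσbot.comp hφ.tendsto_atTop).eventually_le_atBot s] with n hn
  exact mem_iUnion₂.mpr ⟨σ (φ n), hn, mem_iUnion₂.mpr ⟨x (φ n), hx _, hz _⟩⟩

theorem procSet_mono {X : Type*} (U : ℝ → ℝ → X → Set X) (t τ : ℝ) {D E : Set X} (h : D ⊆ E) :
    procSet U t τ D ⊆ procSet U t τ E :=
  biUnion_subset_biUnion_left h

theorem IsStrictMVProcess.procSet_procSet {X : Type*} {U : ℝ → ℝ → X → Set X}
    (hU : IsStrictMVProcess U) {t s r : ℝ} (hrs : r ≤ s) (hst : s ≤ t) (D : Set X) :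
    procSet U t s (procSet U s r D) = procSet U t r D := by
  have h : ∀ x, U t r x = ⋃ y ∈ U s r x, U t s y := fun x => hU.2 t s r x hrs hst
  simp only [procSet, h, biUnion_iUnion]

/-- Theorem (strict invariance): if moreover the attractor family belongs to the universe and
the process is strict, then the attractor is strictly invariant. -/
theorem attractor_strict_invariance {X : Type*} [MetricSpace X]
    (U : ℝ → ℝ → X → Set X) (𝒟 : Set (ℝ → Set X)) (D0 : ℝ → Set X)
    (hU : IsMVProcess U) (husc : IsUSCProcess U)
    (hclosed : ∀ t τ x, IsClosed (U t τ x))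
    (h𝒟 : IsUniverse 𝒟) (hD0ne : ∀ t, (D0 t).Nonempty)
    (habs : PullbackAbsorbing U 𝒟 D0) (hac : AsympCompact U 𝒟)
    (hmem : (fun t => attractorFamily U 𝒟 t) ∈ 𝒟)
    (hstrict : IsStrictMVProcess U) :
    ∀ τ t : ℝ, τ ≤ t → attractorFamily U 𝒟 t = procSet U t τ (attractorFamily U 𝒟 τ) := by
  set A : ℝ → Set X := fun t => attractorFamily U 𝒟 t
  have omega_subset : ∀ D ∈ 𝒟, ∀ t, pbOmegaLimit U D t ⊆ A t := fun D hD t =>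
    (subset_biUnion_of_mem (u := fun D => pbOmegaLimit U D t) hD).trans subset_closure
  have eq_omega : ∀ t, A t = pbOmegaLimit U A t := by
    refine fun t => (closure_minimal (iUnion₂_subset fun D hD y hy => ?_)
      (isClosed_pbOmegaLimit U A t)).antisymm (omega_subset A hmem t)
    exact mem_pbOmegaLimit_of_forall_le fun s hs => procSet_mono U t s (omega_subset D hD s)
      (pbOmegaLimit_subset_procSet hU husc hclosed (hac D hD) hs hy)
  have neg_inv : ∀ τ t, τ ≤ t → A t ⊆ procSet U t τ (A τ) := by
    intro τ t hτ
    rw [eq_omega t, eq_omega τ]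
    exact pbOmegaLimit_subset_procSet hU husc hclosed (hac A hmem) hτ
  intro τ t hτ
  refine (neg_inv τ t hτ).antisymm fun y hy => ?_
  rw [eq_omega t]
  refine mem_pbOmegaLimit_of_forall_le (τ := τ) fun s hs => ?_
  rw [← hstrict.procSet_procSet hs hτ]
  exact procSet_mono U t τ (neg_inv s τ hs) hy
end

section
/- Let U be a multivalued process on a metric space (X,d) and let D̂ = {D(t)}_{t∈ℝ} be a fixed family of nonempty subsets of X such that U is pullback D̂-asymptotically compact. Then for every t ∈ ℝ the omega-limit set Λ(D̂,t) is nonempty and compact, the family {Λ(D̂,t)}_{t∈ℝ} pullback attracts D̂, and it is the minimal family of closed sets pullback attracting D̂: if {C(t)}_{t∈ℝ} is any family of closed subsets of X that pullback attracts D̂, then Λ(D̂,t) ⊆ C(t) for every t ∈ ℝ. -/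
open Set Filter Topology

theorem exists_dist_lt_of_mem_pbOmegaLimit {X : Type*} [MetricSpace X]
    {U : ℝ → ℝ → X → Set X} {D : ℝ → Set X} {t : ℝ} {z : X} (hz : z ∈ pbOmegaLimit U D t)
    (s : ℝ) {ε : ℝ} (hε : 0 < ε) :
    ∃ τ ≤ min s t, ∃ y ∈ procSet U t τ (D τ), dist z y < ε := by
  have h := mem_iInter₂.1 hz (min s t) (min_le_right s t)
  obtain ⟨y, hy, hyz⟩ := Metric.mem_closure_iff.1 h ε hε
  obtain ⟨τ, hτ, hy⟩ := mem_iUnion₂.1 hy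
  exact ⟨τ, hτ, y, hy, hyz⟩

theorem tendsto_atBot_of_le_neg_nat {u : ℕ → ℝ} (hu : ∀ n : ℕ, u n ≤ -(n : ℝ)) :
    Tendsto u atTop atBot :=
  tendsto_atBot_mono hu (tendsto_neg_atTop_atBot.comp tendsto_natCast_atTop_atTop)

/-- Pullback trajectories of an asymptotically compact family accumulate on the omega-limit
set. -/
theorem AsympCompactFor.exists_subseq_tendsto {X : Type*} [MetricSpace X]
    {U : ℝ → ℝ → X → Set X} {D : ℝ → Set X} (hac : AsympCompactFor U D) {t : ℝ}
    {τ : ℕ → ℝ} {y : ℕ → X} (hτt : ∀ n, τ n ≤ t) (hτ : Tendsto τ atTop atBot)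
    (hy : ∀ n, y n ∈ procSet U t (τ n) (D (τ n))) :
    ∃ z ∈ pbOmegaLimit U D t, ∃ φ : ℕ → ℕ, StrictMono φ ∧ Tendsto (y ∘ φ) atTop (𝓝 z) := by
  have hx : ∀ n, ∃ x ∈ D (τ n), y n ∈ U t (τ n) x := fun n => by
    simpa [procSet] using hy n
  choose x hxD hxU using hx
  obtain ⟨z, -, φ, hφ, hlim⟩ := (hac t τ x y hτt hτ hxD hxU).tendsto_subseq
    fun n => subset_closure (mem_range_self n)
  refine ⟨z, mem_iInter₂.2 fun s _ => ?_, φ, hφ, hlim⟩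
  refine mem_closure_of_tendsto hlim ?_
  filter_upwards [(hτ.comp hφ.tendsto_atTop).eventually_le_atBot s] with n hn
  exact mem_iUnion₂.2 ⟨τ (φ n), hn, hy (φ n)⟩

theorem AsympCompactFor.nonempty_pbOmegaLimit {X : Type*} [MetricSpace X]
    {U : ℝ → ℝ → X → Set X} {D : ℝ → Set X} (hac : AsympCompactFor U D)
    (hU : IsMVProcess U) (hDne : ∀ t : ℝ, (D t).Nonempty) (t : ℝ) :
    (pbOmegaLimit U D t).Nonempty := by
  have hy : ∀ n : ℕ, ∃ y, y ∈ procSet U t (min (-(n : ℝ)) t) (D (min (-(n : ℝ)) t)) := fun n => by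
    obtain ⟨x, hx⟩ := hDne (min (-(n : ℝ)) t)
    obtain ⟨y, hy⟩ := hU.1 t (min (-(n : ℝ)) t) x (min_le_right _ _)
    exact ⟨y, mem_iUnion₂.2 ⟨x, hx, hy⟩⟩
  choose y hy using hy
  obtain ⟨z, hz, -⟩ := hac.exists_subseq_tendsto (fun n => min_le_right _ _)
    (tendsto_atBot_of_le_neg_nat fun n => min_le_left _ _) hy
  exact ⟨z, hz⟩

theorem AsympCompactFor.isCompact_pbOmegaLimit {X : Type*} [MetricSpace X]
    {U : ℝ → ℝ → X → Set X} {D : ℝ → Set X} (hac : AsympCompactFor U D) (t : ℝ) :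
    IsCompact (pbOmegaLimit U D t) := by
  refine IsSeqCompact.isCompact fun z hz => ?_
  choose τ hτ y hy hzy using fun n : ℕ =>
    exists_dist_lt_of_mem_pbOmegaLimit (hz n) (-(n : ℝ)) (Nat.one_div_pos_of_nat (α := ℝ) (n := n))
  obtain ⟨a, ha, φ, hφ, hlim⟩ := hac.exists_subseq_tendsto
    (fun n => (hτ n).trans (min_le_right _ _))
    (tendsto_atBot_of_le_neg_nat fun n => (hτ n).trans (min_le_left _ _)) hy
  refine ⟨a, ha, φ, hφ, (tendsto_iff_of_dist ?_).2 hlim⟩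
  exact squeeze_zero (fun _ => dist_nonneg) (fun n => (hzy (φ n)).le)
    (tendsto_one_div_add_atTop_nhds_zero_nat.comp hφ.tendsto_atTop)

theorem AsympCompactFor.pullbackAttracts_pbOmegaLimit {X : Type*} [MetricSpace X]
    {U : ℝ → ℝ → X → Set X} {D : ℝ → Set X} (hac : AsympCompactFor U D) :
    PullbackAttracts U (pbOmegaLimit U D) D := by
  intro t ε hε
  by_contra! h
  choose τ hτ y hy hfar using fun n : ℕ => h (min (-(n : ℝ)) t)
  obtain ⟨a, ha, φ, -, hlim⟩ := hac.exists_subseq_tendsto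
    (fun n => (hτ n).trans (min_le_right _ _))
    (tendsto_atBot_of_le_neg_nat fun n => (hτ n).trans (min_le_left _ _)) hy
  obtain ⟨n, hn⟩ := (hlim.eventually (Metric.ball_mem_nhds a hε)).exists
  exact (hfar (φ n) a ha).not_gt hn

theorem PullbackAttracts.pbOmegaLimit_subset {X : Type*} [MetricSpace X]
    {U : ℝ → ℝ → X → Set X} {C D : ℝ → Set X} (hC : PullbackAttracts U C D) {t : ℝ}
    (hclosed : IsClosed (C t)) : pbOmegaLimit U D t ⊆ C t := by
  intro z hz
  rw [← hclosed.closure_eq, Metric.mem_closure_iff]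
  intro ε hε
  obtain ⟨T, hT⟩ := hC t (ε / 2) (half_pos hε)
  obtain ⟨τ, hτ, y, hy, hzy⟩ := exists_dist_lt_of_mem_pbOmegaLimit hz T (half_pos hε)
  obtain ⟨a, ha, hya⟩ := hT τ (hτ.trans (min_le_left _ _)) y hy
  exact ⟨a, ha, by linarith [dist_triangle z y a]⟩

/-- Theorem (omega-limit sets as minimal attracting families): if `U` is pullback
`D`-asymptotically compact for a fixed family `D` of nonempty subsets, then `Λ(D,t)` is
nonempty and compact for every `t`, the family `{Λ(D,t)}` pullback attracts `D`, and it is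
minimal among families of closed sets that pullback attract `D`. -/
theorem omegaLimit_minimal_attracting {X : Type*} [MetricSpace X]
    (U : ℝ → ℝ → X → Set X) (D : ℝ → Set X)
    (hU : IsMVProcess U) (hDne : ∀ t : ℝ, (D t).Nonempty)
    (hac : AsympCompactFor U D) :
    (∀ t : ℝ, (pbOmegaLimit U D t).Nonempty ∧ IsCompact (pbOmegaLimit U D t)) ∧
    PullbackAttracts U (pbOmegaLimit U D) D ∧
    (∀ C : ℝ → Set X, (∀ t, IsClosed (C t)) → PullbackAttracts U C D →
      ∀ t : ℝ, pbOmegaLimit U D t ⊆ C t) := by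
  exact ⟨fun t => ⟨hac.nonempty_pbOmegaLimit hU hDne t, hac.isCompact_pbOmegaLimit t⟩,
    hac.pullbackAttracts_pbOmegaLimit,
    fun C hclosed hC t => hC.pbOmegaLimit_subset (hclosed t)⟩
end

section
/- Let U be a multivalued process on a metric space (X,d), let D be a universe in X, and let D̂_0 = {D_0(t)}_{t∈ℝ} be a family of nonempty subsets of X which is pullback D-absorbing for U. If U is pullback D̂_0-asymptotically compact, then U is pullback D-asymptotically compact. -/
open Set Filter Topology

/-- A diagonal choice: if each `P k` holds eventually, then `P (k n) n` holds eventually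
along some `k` tending to infinity. -/
theorem exists_tendsto_atTop_eventually {P : ℕ → ℕ → Prop} (h : ∀ k, ∀ᶠ n in atTop, P k n) :
    ∃ k : ℕ → ℕ, Tendsto k atTop atTop ∧ ∀ᶠ n in atTop, P (k n) n := by
  classical
  refine ⟨fun n => Nat.findGreatest (fun j => P j n) n, tendsto_atTop.2 fun K => ?_, ?_⟩
  · filter_upwards [h K, eventually_ge_atTop K] with n hn hKn
    exact Nat.le_findGreatest hKn hn
  · filter_upwards [h 0] with n hn
    exact Nat.findGreatest_spec (P := fun j => P j n) (Nat.zero_le n) hn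

/-- The range of a sequence is relatively compact as soon as that of one of its tails is. -/
theorem isCompact_closure_range_of_tail {X : Type*} [TopologicalSpace X] [T1Space X]
    {y : ℕ → X} (N : ℕ) (h : IsCompact (closure (range fun n => y (n + N)))) :
    IsCompact (closure (range y)) := by
  have hfin : (y '' Iio N).Finite := (finite_Iio N).image y
  have hrange : range y = y '' Iio N ∪ range fun n => y (n + N) := by
    refine Subset.antisymm ?_ (union_subset (image_subset_range _ _) ?_)
    · rintro _ ⟨n, rfl⟩
      rcases lt_or_ge n N with hn | hn
      · exact Or.inl ⟨n, hn, rfl⟩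
      · exact Or.inr ⟨n - N, by simp [Nat.sub_add_cancel hn]⟩
    · rintro _ ⟨n, rfl⟩
      exact ⟨n + N, rfl⟩
  rw [hrange, closure_union, hfin.isClosed.closure_eq]
  exact hfin.isCompact.union h

/-- Theorem: if `D0` is pullback `𝒟`-absorbing for `U` and `U` is pullback
`D0`-asymptotically compact, then `U` is pullback `𝒟`-asymptotically compact. -/
theorem asympCompact_of_absorbing {X : Type*} [MetricSpace X]
    (U : ℝ → ℝ → X → Set X) (𝒟 : Set (ℝ → Set X)) (D0 : ℝ → Set X)
    (hU : IsMVProcess U) (h𝒟 : IsUniverse 𝒟) (hD0ne : ∀ t : ℝ, (D0 t).Nonempty)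
    (habs : PullbackAbsorbing U 𝒟 D0) (hac : AsympCompactFor U D0) :
    AsympCompact U 𝒟 := by
  intro D hD t τn xn yn _ hτ hx hy
  choose T hTle hT using fun s => habs s D hD
  obtain ⟨k, hk, hkT⟩ := exists_tendsto_atTop_eventually
    (P := fun k n => τn n ≤ T (t - k)) fun k => tendsto_atBot.1 hτ _
  obtain ⟨N, hN⟩ := eventually_atTop.1 hkT
  have hz : ∀ n, ∃ z ∈ D0 (t - k (n + N)), yn (n + N) ∈ U t (t - k (n + N)) z := by
    intro n
    have hτT := hN (n + N) (Nat.le_add_left N n)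
    have hmem := hU.2.2 t (t - k (n + N)) _ _ (hτT.trans (hTle _))
      (sub_le_self t (Nat.cast_nonneg _)) (hy (n + N))
    obtain ⟨z, hz, hyz⟩ := mem_iUnion₂.1 hmem
    exact ⟨z, hT _ _ hτT (mem_iUnion₂.2 ⟨_, hx _, hz⟩), hyz⟩
  choose z hzD hyz using hz
  have hs : Tendsto (fun n => t - (k (n + N) : ℝ)) atTop atBot :=
    tendsto_atBot_add_const_left _ t (tendsto_neg_atTop_atBot.comp
      (tendsto_natCast_atTop_atTop.comp (hk.comp (tendsto_add_atTop_nat N))))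
  exact isCompact_closure_range_of_tail N
    (hac t _ z _ (fun n => sub_le_self t (Nat.cast_nonneg _)) hs hzD hyz)
end
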